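/- arXiv:1907.13094 — 2 statements merged into one kernel-verified Lean document; each statement's English description precedes it below -/
import Mathlib

section
/- For distinct positive integers i ≠ j, the box adding operator 𝔱_i and the box removing operator 𝔡_j commute: 𝔱_i 𝔡_j = 𝔡_j 𝔱_i as operators on weak compositions. -/
namespace CompOps

/-- Subtract 1 from the rightmost part equal to `i`; `none` if no part equals `i`. -/
def removeAux (i : ℕ) : List ℕ → Option (List ℕ)
  | [] => none
  | x :: xs =>
    match removeAux i xs with
    | some ys => some (x :: ys)
    | none => if x = i then some ((i - 1) :: xs) else none

/-- The box removing operator `𝔡ᵢ`, acting on weak compositions together with a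
formal zero (`none`); `𝔡₀` is the identity. -/
def d : ℕ → Option (List ℕ) → Option (List ℕ)
  | 0, o => o
  | i + 1, o => o.bind (removeAux (i + 1))

/-- The appending operator `aᵢ`, appending a part `i` at the end. -/
def a (i : ℕ) : Option (List ℕ) → Option (List ℕ) :=
  Option.map (fun l => l ++ [i])

/-- `𝔡_I` for a finite set `I = {i₁ < ⋯ < i_k}`: the composite
`𝔡_{i₁}𝔡_{i₂}⋯𝔡_{i_k}`, where `𝔡_{i_k}` (the largest index) acts first. -/
def dSet (I : Finset ℕ) : Option (List ℕ) → Option (List ℕ) :=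
  (I.sort (· ≤ ·)).foldr (fun i f => d i ∘ f) id

/-- The jdt operator `𝔲ᵢ = aᵢ 𝔡_{[i-1]}` (with `𝔲₀` the identity). -/
def u : ℕ → Option (List ℕ) → Option (List ℕ)
  | 0 => id
  | i + 1 => a (i + 1) ∘ dSet (Finset.Icc 1 i)

/-- Add 1 to the leftmost part equal to `j`; `none` if no part equals `j`. -/
def addAux (j : ℕ) : List ℕ → Option (List ℕ)
  | [] => none
  | x :: xs => if x = j then some ((x + 1) :: xs) else (addAux j xs).map (x :: ·)

/-- The box adding operator `𝔱ᵢ`: `𝔱₁` prepends a part 1, and for `i ≥ 2`, `𝔱ᵢ`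
adds 1 to the leftmost part equal to `i - 1` (formal zero if there is none). -/
def t : ℕ → Option (List ℕ) → Option (List ℕ)
  | 0 => id
  | 1 => Option.map (fun l => 1 :: l)
  | i + 2 => fun o => o.bind (addAux (i + 1))

theorem removeAux_eq_none_iff (j : ℕ) (l : List ℕ) : removeAux j l = none ↔ j ∉ l := by
  induction l with
  | nil => simp [removeAux]
  | cons x xs ih =>
    cases hr : removeAux j xs <;> by_cases hx : x = j <;> simp_all [removeAux, eq_comm]

theorem addAux_eq_none_iff (k : ℕ) (l : List ℕ) : addAux k l = none ↔ k ∉ l := by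
  induction l with
  | nil => simp [addAux]
  | cons x xs ih => by_cases hx : x = k <;> simp_all [addAux, eq_comm]

theorem mem_of_addAux_eq_some {k j : ℕ} (hjk : j ≠ k) {l m : List ℕ}
    (h : addAux k l = some m) (hj : j ∈ l) : j ∈ m := by
  induction l generalizing m with
  | nil => simp at hj
  | cons x xs ih =>
    by_cases hx : x = k
    · subst hx
      simp only [addAux, if_true, Option.some.injEq] at h
      subst h
      simp_all
    · simp only [addAux, if_neg hx, Option.map_eq_some_iff] at h
      obtain ⟨zs, hz, rfl⟩ := h
      rcases List.mem_cons.1 hj with rfl | hj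
      · simp
      · exact List.mem_cons_of_mem _ (ih hz hj)

theorem removeAux_bind_addAux (k j : ℕ) (hj : 1 ≤ j) (hjk : j ≠ k + 1) :
    ∀ l : List ℕ, (removeAux j l).bind (addAux k) = (addAux k l).bind (removeAux j)
  | [] => rfl
  | x :: xs => by
    have ih := removeAux_bind_addAux k j hj hjk xs
    have hnone : removeAux k xs = none → addAux k xs = none := by
      rw [removeAux_eq_none_iff, addAux_eq_none_iff]
      exact id
    have hjk' : j - 1 ≠ k := by omega
    have hkj : k + 1 ≠ j := hjk.symm
    rcases hr : removeAux j xs with _ | ys <;> rcases ha : addAux k xs with _ | zs <;>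
      simp only [hr, ha, Option.bind_none, Option.bind_some] at ih
    · by_cases hxk : x = k <;> by_cases hxj : x = j <;> simp_all [removeAux, addAux]
    · have hz : removeAux j zs = none := ih.symm
      have hne : j ≠ k := by
        rintro rfl
        simp [hnone hr] at ha
      clear ih hnone
      by_cases hxk : x = k <;> by_cases hxj : x = j <;> simp_all [removeAux, addAux]
    · by_cases hxk : x = k <;> by_cases hxj : x = j <;> simp_all [removeAux, addAux]
    · clear hnone
      have hmem : j ≠ k → removeAux j zs ≠ none := fun hne hz =>
        (removeAux_eq_none_iff j zs).1 hz <| mem_of_addAux_eq_some hne ha <| by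
          by_contra hj'
          simp [(removeAux_eq_none_iff j xs).2 hj'] at hr
      rcases hz : removeAux j zs with _ | ws <;> rw [hz] at ih hmem <;>
        by_cases hxk : x = k <;> by_cases hxj : x = j <;> simp_all [removeAux, addAux]

/-- Lemma 2.14: `𝔱ᵢ 𝔡ⱼ = 𝔡ⱼ 𝔱ᵢ` for distinct positive integers `i ≠ j`. -/
theorem t_comm_d (i j : ℕ) (hi : 1 ≤ i) (hj : 1 ≤ j) (hij : i ≠ j) (α : List ℕ) :
    t i (d j (some α)) = d j (t i (some α)) := by
  obtain ⟨j, rfl⟩ := Nat.exists_eq_add_of_le' hj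
  match i, hi with
  | 1, _ =>
    have h1 : 1 ≠ j + 1 := hij
    cases hr : removeAux (j + 1) α <;> simp_all [t, d, removeAux]
  | i + 2, _ => exact removeAux_bind_addAux (i + 1) (j + 1) hj hij.symm α

end CompOps
end

section
/- On the free vector space KP with basis the set of all compositions, the up operator U = Σ_{i≥1} 𝔲_i and the filtered down operator D̃ = Σ_{∅≠I⊂ℕ finite} 𝔡_I satisfy D̃U − UD̃ = D̃ + Id. (Equivalently, the right composition poset R_c and the strong filtered graph Q̃_c are dual filtered graphs.) -/
namespace CompOps

/-- Compositions: finite lists of positive integers. -/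
abbrev Comp := {l : List ℕ // ∀ x ∈ l, 0 < x}

/-- Send a weak composition (or the formal zero `none`) to the basis vector of `KP`
(with `K = ℚ`) indexed by its underlying composition (or to `0`), as a linear map
from the coefficient field. -/
noncomputable def sgl : Option (List ℕ) → (ℚ →ₗ[ℚ] (Comp →₀ ℚ))
  | none => 0
  | some l =>
    Finsupp.lsingle ⟨l.filter (fun x => 0 < x), fun x hx => by
      simp only [List.mem_filter, decide_eq_true_eq] at hx
      exact hx.2⟩

/-- The linear endomorphism of `KP` given by the (pointwise finitely supported)
sum `Σ_{i ≥ 1} F i` of a family of operators on weak compositions. -/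
noncomputable def sumOp (F : ℕ → Option (List ℕ) → Option (List ℕ)) :
    (Comp →₀ ℚ) →ₗ[ℚ] (Comp →₀ ℚ) :=
  Finsupp.lsum ℚ fun c => ∑ᶠ i ∈ Set.Ici (1 : ℕ), sgl (F i (some c.1))

/-- The filtered down operator `D̃ = Σ_{∅ ≠ I ⊂ ℕ finite} 𝔡_I` as a linear
endomorphism of `KP`. -/
noncomputable def filteredD : (Comp →₀ ℚ) →ₗ[ℚ] (Comp →₀ ℚ) :=
  Finsupp.lsum ℚ fun c =>
    ∑ᶠ I ∈ {I : Finset ℕ | I.Nonempty ∧ ∀ j ∈ I, 0 < j}, sgl (dSet I (some c.1))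
section

open Finset Filter

/-! ### An identity in rings with plactic-type relations -/

section RingIdentity

variable {R : Type*} [Ring R] (δ α : ℕ → R)

/-- The ordered product `δ₀ δ₁ ⋯ δₙ₋₁`. -/
def orderedProd (n : ℕ) : R := ((List.range n).map δ).prod

/-- The ordered product `(1 + δ₀) (1 + δ₁) ⋯ (1 + δₙ₋₁)`. -/
def orderedProdOneAdd (n : ℕ) : R := orderedProd (fun i => 1 + δ i) n

/-- The partial sum `∑_{i < n} αᵢ₊₁ δ₀ ⋯ δᵢ₋₁`. -/
def upSum (n : ℕ) : R := ∑ i ∈ range n, α (i + 1) * orderedProd δ i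

@[simp] lemma orderedProd_zero : orderedProd δ 0 = 1 := by simp [orderedProd]

lemma orderedProd_succ (n : ℕ) : orderedProd δ (n + 1) = orderedProd δ n * δ n := by
  simp [orderedProd, List.range_succ]

@[simp] lemma orderedProdOneAdd_zero : orderedProdOneAdd δ 0 = 1 := orderedProd_zero _

lemma orderedProdOneAdd_succ (n : ℕ) :
    orderedProdOneAdd δ (n + 1) = orderedProdOneAdd δ n * (1 + δ n) := orderedProd_succ _ n

variable {δ α}

lemma commute_orderedProd {x : R} {n : ℕ} (h : ∀ i < n, Commute x (δ i)) :
    Commute x (orderedProd δ n) := by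
  induction n with
  | zero => simp
  | succ n ih =>
    rw [orderedProd_succ]
    exact (ih fun i hi => h i (by omega)).mul_right (h n (by omega))

lemma commute_orderedProdOneAdd {x : R} {n : ℕ} (h : ∀ i < n, Commute x (δ i)) :
    Commute x (orderedProdOneAdd δ n) :=
  commute_orderedProd fun i hi => (Commute.one_right x).add_right (h i hi)

/-- With plactic relations, `δ₀ ⋯ δₙ₋₁` commutes with each of its factors. -/
lemma orderedProd_commute_factor (hcomm : ∀ i j, i + 2 ≤ j → Commute (δ j) (δ i))
    (hleft : ∀ i, δ i * δ (i + 1) * δ i = δ i * δ i * δ (i + 1))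
    (hright : ∀ i, δ i * δ (i + 1) * δ (i + 1) = δ (i + 1) * δ i * δ (i + 1))
    {n i : ℕ} (hi : i < n) : Commute (δ i) (orderedProd δ n) := by
  induction n with
  | zero => omega
  | succ n ih =>
    rcases Nat.lt_succ_iff_lt_or_eq.mp hi with hin | rfl
    · rcases Nat.lt_or_ge (i + 1) n with h | h
      · rw [orderedProd_succ]
        exact (ih hin).mul_right (hcomm i n h).symm
      · obtain rfl : n = i + 1 := by omega
        have hP := (ih hin).eq
        rw [orderedProd_succ] at hP
        rw [orderedProd_succ, orderedProd_succ, Commute, SemiconjBy]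
        calc δ i * (orderedProd δ i * δ i * δ (i + 1))
            = δ i * (orderedProd δ i * δ i) * δ (i + 1) := (mul_assoc _ _ _).symm
          _ = orderedProd δ i * (δ i * δ i * δ (i + 1)) := by rw [hP]; simp only [mul_assoc]
          _ = orderedProd δ i * δ i * δ (i + 1) * δ i := by
            rw [← hleft]; simp only [mul_assoc]
    · cases i with
      | zero => simp [orderedProd_succ]
      | succ i =>
        have hP : Commute (δ (i + 1)) (orderedProd δ i) :=
          commute_orderedProd fun j hj => hcomm j (i + 1) (by omega)
        simp only [orderedProd_succ, Commute, SemiconjBy]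
        have h₁ := hright i
        simp only [mul_assoc] at h₁ ⊢
        rw [h₁, ← mul_assoc, hP.eq, mul_assoc]

theorem orderedProdOneAdd_mul_upSum
    (hcomm : ∀ i j, i + 2 ≤ j → Commute (δ j) (δ i))
    (hleft : ∀ i, δ i * δ (i + 1) * δ i = δ i * δ i * δ (i + 1))
    (hright : ∀ i, δ i * δ (i + 1) * δ (i + 1) = δ (i + 1) * δ i * δ (i + 1))
    (hne : ∀ i j, i ≠ j + 1 → Commute (δ j) (α i))
    (hself : ∀ i, δ i * α (i + 1) = α i) (hzero : α 0 = 1) (n : ℕ) :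
    orderedProdOneAdd δ n * (upSum δ α n + α n * orderedProd δ n) =
      (upSum δ α n + 1) * orderedProdOneAdd δ n := by
  induction n with
  | zero => simp [upSum, hzero]
  | succ n ih =>
    have hU : upSum δ α (n + 1) = upSum δ α n + α (n + 1) * orderedProd δ n :=
      sum_range_succ _ n
    have hδU : Commute (δ n) (upSum δ α n) := by
      refine Commute.sum_right _ _ _ fun i hi => ?_
      rw [mem_range] at hi
      exact (hne _ _ (by omega)).mul_right
        (commute_orderedProd fun j hj => hcomm j n (by omega))
    have hαE : Commute (α (n + 1)) (orderedProdOneAdd δ n) :=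
      commute_orderedProdOneAdd fun i hi => (hne _ _ (by omega)).symm
    have hPE : Commute (orderedProd δ n) (orderedProdOneAdd δ n) :=
      commute_orderedProdOneAdd fun i hi =>
        (orderedProd_commute_factor hcomm hleft hright hi).symm
    rw [hU, orderedProd_succ, orderedProdOneAdd_succ]
    generalize orderedProdOneAdd δ n = E at *
    generalize orderedProd δ n = P at *
    generalize upSum δ α n = U at *
    calc E * (1 + δ n) * (U + α (n + 1) * P + α (n + 1) * (P * δ n))
        = E * ((1 + δ n) * U) + E * (α (n + 1) + δ n * α (n + 1)) * P * (1 + δ n) := by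
          noncomm_ring
      _ = E * (U * (1 + δ n)) + E * (α (n + 1) + α n) * P * (1 + δ n) := by
          rw [hself, ((Commute.one_left U).add_left hδU).eq]
      _ = E * (U + α n * P) * (1 + δ n) + E * α (n + 1) * P * (1 + δ n) := by noncomm_ring
      _ = (U + 1) * E * (1 + δ n) + α (n + 1) * (P * E) * (1 + δ n) := by
          rw [ih, ← hαE.eq, hPE.eq]; noncomm_ring
      _ = (U + α (n + 1) * P + 1) * (E * (1 + δ n)) := by noncomm_ring

end RingIdentity

/-! ### Relations between the operators on weak compositions -/

lemma removeAux_append_singleton (i x : ℕ) (l : List ℕ) :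
    removeAux i (l ++ [x]) =
      if x = i then some (l ++ [i - 1]) else (removeAux i l).map (· ++ [x]) := by
  induction l with
  | nil => simp [removeAux]
  | cons y l ih =>
    rw [List.cons_append, removeAux, ih]
    by_cases h : x = i
    · simp [h]
    · simp only [h, if_false, removeAux]
      cases removeAux i l <;> simp

@[simp] lemma a_none (i : ℕ) : a i none = none := rfl

@[simp] lemma d_none (i : ℕ) : d i none = none := by cases i <;> rfl

@[simp] lemma d_succ_nil (i : ℕ) : d (i + 1) (some []) = none := rfl

lemma d_a_of_ne {i j : ℕ} (h : i ≠ j + 1) (o : Option (List ℕ)) :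
    d (j + 1) (a i o) = a i (d (j + 1) o) := by
  cases o with
  | none => rfl
  | some l => simp [d, a, removeAux_append_singleton, h]

@[simp] lemma d_a_self (i : ℕ) (o : Option (List ℕ)) :
    d (i + 1) (a (i + 1) o) = a i o := by
  cases o with
  | none => rfl
  | some l => simp [d, a, removeAux_append_singleton]

lemma weakComp_induction {motive : Option (List ℕ) → Prop} (none : motive none)
    (nil : motive (some [])) (append : ∀ x o, motive o → motive (a x o))
    (o : Option (List ℕ)) : motive o := by
  cases o with
  | none => exact none
  | some l =>
    induction l using List.reverseRecOn with
    | nil => exact nil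
    | append_singleton l x ih => exact append x (some l) ih

lemma d_comm {i j : ℕ} (h : i + 2 ≤ j) (o : Option (List ℕ)) :
    d (j + 1) (d (i + 1) o) = d (i + 1) (d (j + 1) o) := by
  induction o using weakComp_induction with
  | none => simp
  | nil => simp
  | append x o ih =>
    by_cases hi : x = i + 1
    · subst hi
      simp only [d_a_self, d_a_of_ne (i := i + 1) (j := j) (by omega),
        d_a_of_ne (i := i) (j := j) (by omega)]
    by_cases hj : x = j + 1
    · subst hj
      simp only [d_a_self, d_a_of_ne (i := j + 1) (j := i) (by omega),
        d_a_of_ne (i := j) (j := i) (by omega)]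
    simp only [d_a_of_ne hi, d_a_of_ne hj, ih]

lemma d_plactic_left (i : ℕ) (o : Option (List ℕ)) :
    d (i + 1) (d (i + 2) (d (i + 1) o)) = d (i + 1) (d (i + 1) (d (i + 2) o)) := by
  induction o using weakComp_induction with
  | none => simp
  | nil => simp
  | append x o ih =>
    by_cases hi : x = i + 1
    · subst hi
      simp only [d_a_self, d_a_of_ne (i := i + 1) (j := i + 1) (by omega),
        d_a_of_ne (i := i) (j := i + 1) (by omega), d_a_of_ne (i := i) (j := i) (by omega)]
    by_cases hj : x = i + 2
    · subst hj
      simp only [d_a_self, d_a_of_ne (i := i + 2) (j := i) (by omega),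
        d_a_of_ne (i := i) (j := i) (by omega)]
    simp only [d_a_of_ne (j := i) hi, d_a_of_ne (j := i + 1) hj, ih]

lemma d_plactic_right (i : ℕ) (o : Option (List ℕ)) :
    d (i + 1) (d (i + 2) (d (i + 2) o)) = d (i + 2) (d (i + 1) (d (i + 2) o)) := by
  induction o using weakComp_induction with
  | none => simp
  | nil => simp
  | append x o ih =>
    by_cases hi : x = i + 1
    · subst hi
      simp only [d_a_self, d_a_of_ne (i := i + 1) (j := i + 1) (by omega),
        d_a_of_ne (i := i) (j := i + 1) (by omega)]
    by_cases hj : x = i + 2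
    · subst hj
      simp only [d_a_self, d_a_of_ne (i := i + 1) (j := i + 1) (by omega),
        d_a_of_ne (i := i) (j := i + 1) (by omega)]
    simp only [d_a_of_ne (j := i) hi, d_a_of_ne (j := i + 1) hj, ih]

lemma d_succ_eq_none {l : List ℕ} {i : ℕ} (hi : ∀ x ∈ l, x < i + 1) :
    d (i + 1) (some l) = none := by
  induction l using List.reverseRecOn with
  | nil => rfl
  | append_singleton l x ih =>
    change d (i + 1) (a x (some l)) = none
    rw [d_a_of_ne (hi x (by simp)).ne, ih fun y hy => hi y (by simp [hy]), a_none]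

lemma dSet_empty : dSet ∅ = id := by simp [dSet]

lemma dSet_insert_of_lt {I : Finset ℕ} {m : ℕ} (hI : ∀ i ∈ I, i < m) :
    dSet (insert m I) = dSet I ∘ d m := by
  have hsort : (insert m I).sort (· ≤ ·) = I.sort (· ≤ ·) ++ [m] := by
    have hm : m ∉ I := fun h => (hI m h).false
    have htoFinset : (I.sort (· ≤ ·) ++ [m]).toFinset = insert m I := by
      ext x; simp
    rw [← htoFinset, List.toFinset_sort]
    · simpa [List.pairwise_append] using fun i hi => (hI i hi).le
    · simpa [List.nodup_append] using fun i hi => (hI i hi).ne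
  have hfold : ∀ L : List ℕ, (L ++ [m]).foldr (fun i f => d i ∘ f) id =
      L.foldr (fun i f => d i ∘ f) id ∘ d m := by
    intro L
    induction L with
    | nil => rfl
    | cons x L ih => simp only [List.cons_append, List.foldr_cons, ih, Function.comp_assoc]
  rw [dSet, hsort, hfold, dSet]

@[simp] lemma dSet_none (I : Finset ℕ) : dSet I none = none := by
  have hfold : ∀ L : List ℕ, L.foldr (fun i f => d i ∘ f) id none = none := by
    intro L
    induction L with
    | nil => rfl
    | cons x L ih => simp [ih]
  exact hfold _

lemma dSet_eq_none {l : List ℕ} {I : Finset ℕ} {m : ℕ} (hm : m ∈ I) (hpos : 0 < m)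
    (hl : ∀ x ∈ l, x < m) : dSet I (some l) = none := by
  have hne : I.Nonempty := ⟨m, hm⟩
  have hle : m ≤ I.max' hne := I.le_max' m hm
  obtain ⟨k, hk⟩ : ∃ k, I.max' hne = k + 1 := ⟨I.max' hne - 1, by omega⟩
  rw [← insert_erase (I.max'_mem hne), dSet_insert_of_lt fun i hi =>
    I.lt_max'_of_mem_erase_max' hne hi, Function.comp_apply, hk,
    d_succ_eq_none fun x hx => by have := hl x hx; omega, dSet_none]

/-! ### Passage to underlying compositions -/

/-- The underlying composition of a weak composition, as a list. -/
def strip : Option (List ℕ) → Option (List ℕ) :=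
  Option.map (List.filter (fun x => 0 < x))

@[simp] lemma strip_none : strip none = none := rfl

@[simp] lemma strip_strip (o : Option (List ℕ)) : strip (strip o) = strip o := by
  cases o <;> simp [strip]

lemma strip_a (x : ℕ) (o : Option (List ℕ)) :
    strip (a x o) = if x = 0 then strip o else a x (strip o) := by
  cases o with
  | none => simp
  | some l =>
    by_cases hx : x = 0
    · simp [strip, a, hx]
    · simp [strip, a, hx, Nat.pos_of_ne_zero hx]

lemma sgl_strip (o : Option (List ℕ)) : sgl (strip o) = sgl o := by
  cases o with
  | none => rfl
  | some l => simp [strip, sgl]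

/-- An operator descends to underlying compositions. -/
structure Descends (F : Option (List ℕ) → Option (List ℕ)) : Prop where
  map_none : F none = none
  strip_comm : ∀ o, strip (F (strip o)) = strip (F o)

lemma Descends.id : Descends id := ⟨rfl, strip_strip⟩

lemma Descends.comp {F G : Option (List ℕ) → Option (List ℕ)} (hF : Descends F)
    (hG : Descends G) : Descends (F ∘ G) where
  map_none := by simp [hF.map_none, hG.map_none]
  strip_comm o := by
    simp only [Function.comp_apply]
    rw [← hF.strip_comm, hG.strip_comm, hF.strip_comm]

lemma descends_a (i : ℕ) : Descends (a i) where
  map_none := rfl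
  strip_comm o := by simp [strip_a]

lemma descends_d (i : ℕ) : Descends (d i) where
  map_none := d_none i
  strip_comm o := by
    cases i with
    | zero => exact strip_strip o
    | succ i =>
      induction o using weakComp_induction with
      | none => rfl
      | nil => rfl
      | append x o ih =>
        by_cases hx : x = i + 1
        · subst hx
          simp [strip_a]
        · rw [strip_a, d_a_of_ne hx, strip_a]
          split_ifs
          · exact ih
          · rw [d_a_of_ne hx, strip_a, ih]
            simp [*]

lemma descends_dSet (I : Finset ℕ) : Descends (dSet I) := by
  have hfold : ∀ L : List ℕ, Descends (L.foldr (fun i f => d i ∘ f) id) := by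
    intro L
    induction L with
    | nil => exact Descends.id
    | cons x L ih => exact (descends_d x).comp ih
  exact hfold _

/-! ### The induced linear operators -/

/-- The linear endomorphism of `KP` induced by an operator on weak compositions. -/
noncomputable def linearize (F : Option (List ℕ) → Option (List ℕ)) :
    Module.End ℚ (Comp →₀ ℚ) :=
  Finsupp.lsum ℚ fun c => sgl (F (some c.1))

@[simp] lemma linearize_single (F : Option (List ℕ) → Option (List ℕ)) (c : Comp) (r : ℚ) :
    linearize F (Finsupp.single c r) = sgl (F (some c.1)) r := by
  simp [linearize]

lemma sgl_comp (c : Comp) (r : ℚ) : sgl (some c.1) r = Finsupp.single c r := by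
  have hc : c.1.filter (fun x => 0 < x) = c.1 :=
    List.filter_eq_self.mpr fun x hx => by simpa using c.2 x hx
  simp [sgl, hc]

lemma linearize_sgl {F : Option (List ℕ) → Option (List ℕ)} (hF : Descends F)
    (o : Option (List ℕ)) (r : ℚ) : linearize F (sgl o r) = sgl (F o) r := by
  cases o with
  | none => simp [sgl, hF.map_none]
  | some l =>
    rw [← sgl_strip (F (some l)), ← hF.strip_comm, sgl_strip]
    exact linearize_single _ _ _

lemma linearize_comp {F : Option (List ℕ) → Option (List ℕ)} (hF : Descends F)
    (G : Option (List ℕ) → Option (List ℕ)) :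
    linearize (F ∘ G) = linearize F * linearize G := by
  refine Finsupp.lhom_ext fun c r => ?_
  rw [Module.End.mul_apply, linearize_single, linearize_single, linearize_sgl hF]
  rfl

lemma linearize_id : linearize id = 1 := by
  refine Finsupp.lhom_ext fun c r => ?_
  simpa using sgl_comp c r

lemma linearize_a_zero : linearize (a 0) = 1 := by
  refine Finsupp.lhom_ext fun c r => ?_
  rw [linearize_single, ← sgl_strip, strip_a, if_pos rfl, sgl_strip, sgl_comp]
  rfl

/-- The box removing operator `𝔡ᵢ₊₁` on `KP`. -/
noncomputable def dLin (i : ℕ) : Module.End ℚ (Comp →₀ ℚ) := linearize (d (i + 1))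

/-- The appending operator `aᵢ` on `KP`. -/
noncomputable def aLin (i : ℕ) : Module.End ℚ (Comp →₀ ℚ) := linearize (a i)

lemma dLin_mul_dLin (i j : ℕ) : dLin i * dLin j = linearize (d (i + 1) ∘ d (j + 1)) :=
  (linearize_comp (descends_d _) _).symm

lemma dLin_mul_dLin_mul_dLin (i j k : ℕ) :
    dLin i * dLin j * dLin k = linearize (d (i + 1) ∘ d (j + 1) ∘ d (k + 1)) := by
  rw [mul_assoc, dLin_mul_dLin, linearize_comp (descends_d _) (d (j + 1) ∘ d (k + 1)), dLin]

theorem dLin_aLin_intertwine (n : ℕ) :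
    orderedProdOneAdd dLin n * (upSum dLin aLin n + aLin n * orderedProd dLin n) =
      (upSum dLin aLin n + 1) * orderedProdOneAdd dLin n := by
  refine orderedProdOneAdd_mul_upSum (fun i j h => ?_) (fun i => ?_) (fun i => ?_)
    (fun i j h => ?_) (fun i => ?_) linearize_a_zero n
  · rw [Commute, SemiconjBy, dLin_mul_dLin, dLin_mul_dLin]
    exact congrArg linearize (funext (d_comm h))
  · rw [dLin_mul_dLin_mul_dLin, dLin_mul_dLin_mul_dLin]
    exact congrArg linearize (funext (d_plactic_left i))
  · rw [dLin_mul_dLin_mul_dLin, dLin_mul_dLin_mul_dLin]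
    exact congrArg linearize (funext (d_plactic_right i))
  · rw [Commute, SemiconjBy, dLin, aLin, ← linearize_comp (descends_d _),
      ← linearize_comp (descends_a _)]
    exact congrArg linearize (funext (d_a_of_ne h))
  · rw [dLin, aLin, ← linearize_comp (descends_d _)]
    exact congrArg linearize (funext (d_a_self i))

lemma linearize_dSet_insert {I : Finset ℕ} {n : ℕ} (hI : I ⊆ Icc 1 n) :
    linearize (dSet (insert (n + 1) I)) = linearize (dSet I) * dLin n := by
  rw [dSet_insert_of_lt fun i hi => Nat.lt_succ_of_le (mem_Icc.mp (hI hi)).2,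
    linearize_comp (descends_dSet I), dLin]

lemma orderedProd_dLin (n : ℕ) : orderedProd dLin n = linearize (dSet (Icc 1 n)) := by
  induction n with
  | zero => simp [dSet_empty, linearize_id]
  | succ n ih =>
    rw [orderedProd_succ, ih, ← linearize_dSet_insert Subset.rfl,
      insert_Icc_right_eq_Icc_add_one (by omega)]

lemma orderedProdOneAdd_dLin (n : ℕ) :
    orderedProdOneAdd dLin n = ∑ I ∈ (Icc 1 n).powerset, linearize (dSet I) := by
  induction n with
  | zero => simp [dSet_empty, linearize_id]
  | succ n ih =>
    rw [orderedProdOneAdd_succ, ih, ← insert_Icc_right_eq_Icc_add_one (by omega),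
      sum_powerset_insert (by simp), mul_add, mul_one, sum_mul]
    congr 1
    exact sum_congr rfl fun I hI => (linearize_dSet_insert (mem_powerset.mp hI)).symm

lemma upSum_dLin_aLin (n : ℕ) :
    upSum dLin aLin n = ∑ i ∈ range n, linearize (u (i + 1)) :=
  sum_congr rfl fun i _ => by
    rw [orderedProd_dLin, aLin, ← linearize_comp (descends_a _)]
    rfl

/-! ### Stabilization of the truncated operators -/

lemma eventually_forall_mem_lt (l : List ℕ) : ∀ᶠ n in atTop, ∀ x ∈ l, x < n := by
  simpa using (eventually_all_finset l.toFinset).mpr fun x _ => eventually_gt_atTop x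

lemma eventually_eq_apply {f : Module.End ℚ (Comp →₀ ℚ)} {g : ℕ → Module.End ℚ (Comp →₀ ℚ)}
    (h : ∀ (c : Comp) (r : ℚ) (n : ℕ), 0 < n → (∀ x ∈ c.1, x < n) →
      f (Finsupp.single c r) = g n (Finsupp.single c r)) (v : Comp →₀ ℚ) :
    ∀ᶠ n in atTop, f v = g n v := by
  induction v using Finsupp.induction_linear with
  | zero => simp
  | add v w hv hw =>
    filter_upwards [hv, hw] with n hnv hnw
    rw [map_add, map_add, hnv, hnw]
  | single c r =>
    filter_upwards [eventually_gt_atTop 0, eventually_forall_mem_lt c.1] with n h₀ hn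
      using h c r n h₀ hn

lemma eventually_orderedProd_dLin_apply (v : Comp →₀ ℚ) :
    ∀ᶠ n in atTop, 0 = orderedProd dLin n v := by
  refine eventually_eq_apply (f := 0) (g := orderedProd dLin) (fun c r n h₀ hn => ?_) v
  rw [orderedProd_dLin, linearize_single, dSet_eq_none (mem_Icc.mpr ⟨h₀, le_rfl⟩) h₀ hn]
  rfl

lemma eventually_sumOp_u_apply (v : Comp →₀ ℚ) :
    ∀ᶠ n in atTop, sumOp u v = upSum dLin aLin n v := by
  refine eventually_eq_apply (fun c r n h₀ hn => ?_) v
  have hu : ∀ i, n < i → u i (some c.1) = none := by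
    intro i hi
    obtain ⟨k, rfl⟩ : ∃ k, i = k + 1 := ⟨i - 1, by omega⟩
    have hnk : n ≤ k := Nat.le_of_lt_succ hi
    rw [u, Function.comp_apply, dSet_eq_none (mem_Icc.mpr ⟨h₀.trans_le hnk, le_rfl⟩)
      (h₀.trans_le hnk) fun x hx => (hn x hx).trans_le hnk, a_none]
  have hsum : ∑ᶠ i ∈ Set.Ici (1 : ℕ), sgl (u i (some c.1)) =
      ∑ i ∈ Icc 1 n, sgl (u i (some c.1)) := by
    refine finsum_mem_eq_sum_of_subset _ (fun i ⟨hi, hne⟩ => ?_) fun i hi => ?_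
    · rw [coe_Icc]
      refine ⟨hi, le_of_not_gt fun hlt => hne ?_⟩
      beta_reduce
      rw [hu i hlt]
      rfl
    · exact (mem_Icc.mp hi).1
  rw [upSum_dLin_aLin, sumOp, Finsupp.lsum_single, hsum, range_eq_Ico,
    sum_Ico_add' (fun i => linearize (u i)) 0 n 1]
  simp only [LinearMap.sum_apply, linearize_single]
  rfl

lemma eventually_filteredD_apply (v : Comp →₀ ℚ) :
    ∀ᶠ n in atTop, (filteredD + 1) v = orderedProdOneAdd dLin n v := by
  refine eventually_eq_apply (f := filteredD + 1) (fun c r n h₀ hn => ?_) v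
  have hsum : ∑ᶠ I ∈ {I : Finset ℕ | I.Nonempty ∧ ∀ j ∈ I, 0 < j}, sgl (dSet I (some c.1)) =
      ∑ I ∈ (Icc 1 n).powerset.erase ∅, sgl (dSet I (some c.1)) := by
    refine finsum_mem_eq_sum_of_subset _ (fun I ⟨⟨hI, hpos⟩, hne⟩ => ?_) fun I hI => ?_
    · simp only [coe_erase, Set.mem_sdiff, mem_coe, mem_powerset, Set.mem_singleton_iff]
      refine ⟨fun m hm => mem_Icc.mpr ⟨hpos m hm, le_of_not_gt fun hlt => hne ?_⟩, hI.ne_empty⟩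
      beta_reduce
      rw [dSet_eq_none hm (hpos m hm) fun x hx => (hn x hx).trans hlt]
      rfl
    · simp only [coe_erase, Set.mem_sdiff, mem_coe, mem_powerset, Set.mem_singleton_iff] at hI
      exact ⟨nonempty_iff_ne_empty.mpr hI.2, fun j hj => (mem_Icc.mp (hI.1 hj)).1⟩
  rw [orderedProdOneAdd_dLin, LinearMap.add_apply, filteredD, Finsupp.lsum_single, hsum,
    ← sum_erase_add _ _ (empty_mem_powerset _), LinearMap.add_apply, dSet_empty, linearize_id]
  simp only [LinearMap.sum_apply, linearize_single]

end

/-- Theorem 3.6: the right composition poset `R_c` and the strong filtered graph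
`Q̃_c` are dual filtered graphs: with `U = Σ_{i≥1} 𝔲ᵢ` and `D̃ = Σ_{∅≠I⊂ℕ} 𝔡_I`
acting on the free vector space on compositions, `D̃U - UD̃ = D̃ + Id`. -/
theorem RcQct_dual_filtered :
    filteredD.comp (sumOp u) - (sumOp u).comp filteredD = filteredD + LinearMap.id := by
  have key : (filteredD + 1) * sumOp u = (sumOp u + 1) * (filteredD + 1) := by
    refine LinearMap.ext fun v => ?_
    obtain ⟨n, hP, hU, hE, hEU, hUE⟩ :=
      ((eventually_orderedProd_dLin_apply v).and <| (eventually_sumOp_u_apply v).and <|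
        (eventually_filteredD_apply v).and <| (eventually_filteredD_apply (sumOp u v)).and <|
        eventually_sumOp_u_apply ((filteredD + 1) v)).exists
    have h := LinearMap.congr_fun (dLin_aLin_intertwine n) v
    simp only [Module.End.mul_apply, LinearMap.add_apply (upSum dLin aLin n), ← hP, ← hU,
      ← hE, map_zero, add_zero, ← hEU, ← hUE] at h
    exact h
  change filteredD * sumOp u - sumOp u * filteredD = filteredD + 1
  rw [add_mul, one_mul, add_mul, one_mul, mul_add, mul_one] at key
  rw [sub_eq_iff_eq_add, ← add_left_inj (sumOp u), key]
  abel

end CompOps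
end
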